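/- arXiv:2604.00227 — 7 statements merged into one kernel-verified Lean document; each statement's English description precedes it below -/
import Mathlib

section
/- Let the well-posedness condition I_n − λ(Σ_y²)^{-1/2} R_β^{-1} (Σ_y²)^{-1/2} ⪰ 0 hold (positive semidefinite). Then the backward Riccati recursion P_T = diag(T_v, 0_{n×n}), P_t = Q_t + AᵀP_{t+1}A − G_t H_t^{-1} G_tᵀ (for t = T−1, …, 0), where H_t := R + BᵀP_{t+1}B and G_t := N_t + AᵀP_{t+1}B, is well defined: for every t ∈ {0,…,T−1} the matrix H_t is symmetric positive definite (in particular invertible), and P_t is positive semidefinite for every t ∈ {0,…,T}. -/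
open Matrix

/-- The block-diagonal matrix of a positive definite block and a zero block is positive
semidefinite. -/
theorem Matrix.PosDef.posSemidef_fromBlocks_zero {m n : Type*} [Fintype m] [Fintype n]
    [DecidableEq m] {S : Matrix m m ℝ} (hS : S.PosDef) :
    (fromBlocks S 0 0 (0 : Matrix n n ℝ)).PosSemidef := by
  have := hS.isUnit.invertible
  simpa using (PosDef.fromBlocks₁₁ (0 : Matrix m n ℝ) 0 hS).2 (by simpa using PosSemidef.zero)

/-- The block-diagonal matrix of two positive definite blocks is positive definite. -/
theorem Matrix.PosDef.fromBlocks_diagonal {m n : Type*} [Fintype m] [Fintype n]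
    {S : Matrix m m ℝ} {U : Matrix n n ℝ} (hS : S.PosDef) (hU : U.PosDef) :
    (fromBlocks S 0 0 U).PosDef := by
  classical
  refine PosDef.of_dotProduct_mulVec_pos
    (IsHermitian.fromBlocks hS.isHermitian (by simp) hU.isHermitian) fun x hx => ?_
  have hS' := hS.posSemidef.dotProduct_mulVec_nonneg (x ∘ Sum.inl)
  have hU' := hU.posSemidef.dotProduct_mulVec_nonneg (x ∘ Sum.inr)
  have hsum : star x ⬝ᵥ (fromBlocks S 0 0 U *ᵥ x) =
      star (x ∘ Sum.inl) ⬝ᵥ (S *ᵥ (x ∘ Sum.inl)) +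
        star (x ∘ Sum.inr) ⬝ᵥ (U *ᵥ (x ∘ Sum.inr)) := by
    simp [fromBlocks_mulVec, dotProduct, Fintype.sum_sum_type]
  rw [hsum]
  by_cases hl : x ∘ Sum.inl = 0
  · have hr : x ∘ Sum.inr ≠ 0 := fun hr => hx (by
      ext (i | i)
      · exact congrFun hl i
      · exact congrFun hr i)
    exact add_pos_of_nonneg_of_pos hS' (hU.dotProduct_mulVec_pos hr)
  · exact add_pos_of_pos_of_nonneg (hS.dotProduct_mulVec_pos hl) hU'

/-- One step of the Riccati recursion preserves positive semidefiniteness when the stage cost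
`[[R, Nᵀ], [N, Q]]` is positive semidefinite, expressed by its Schur complement. -/
theorem Matrix.PosSemidef.riccati_step {m k : Type*} [Fintype m] [Fintype k] [DecidableEq m]
    {P Q A : Matrix k k ℝ} {R : Matrix m m ℝ} {B : Matrix k m ℝ} {N : Matrix k m ℝ}
    (hP : P.PosSemidef) (hR : R.PosDef) (hQ : (Q - N * R⁻¹ * Nᵀ).PosSemidef) :
    (Q + Aᵀ * P * A -
      (N + Aᵀ * P * B) * (R + Bᵀ * P * B)⁻¹ * (N + Aᵀ * P * B)ᵀ).PosSemidef := by
  have hPt : Pᵀ = P := by simpa using hP.isHermitian.eq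
  have hH : (R + Bᵀ * P * B).PosDef :=
    hR.add_posSemidef (by simpa using hP.conjTranspose_mul_mul_same B)
  have := hR.isUnit.invertible
  have := hH.isUnit.invertible
  have hstage := (PosDef.fromBlocks₁₁ Nᵀ Q hR).2 (by simpa using hQ)
  have hnext := hP.conjTranspose_mul_mul_same (fromCols B A)
  have hblock : (fromBlocks (R + Bᵀ * P * B) (N + Aᵀ * P * B)ᵀ (N + Aᵀ * P * B)ᵀᴴ
      (Q + Aᵀ * P * A)).PosSemidef := by
    convert! hstage.add hnext using 1
    rw [conjTranspose_fromCols_eq_fromRows_conjTranspose, fromRows_mul, fromRows_mul_fromCols]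
    simp [fromBlocks_add, transpose_mul, hPt, Matrix.mul_assoc]
  simpa using (PosDef.fromBlocks₁₁ _ _ hH).1 hblock

/-- **Well-posedness of the backward Riccati recursion for deceptive LQ control.**
Under the well-posedness condition `I − λ (Σ_y²)^{-1/2} R_β⁻¹ (Σ_y²)^{-1/2} ⪰ 0`,
every `H_t` in the backward recursion is symmetric positive definite (in particular
invertible), and every `P_t` is positive semidefinite. -/
theorem deceptive_lq_riccati_well_posed
    (n T : ℕ) (hn : 1 ≤ n) (hT : 1 ≤ T)
    (Rα Rβ Rv Tv Sy SyHalf : Matrix (Fin n) (Fin n) ℝ)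
    (hRα : Rα.PosDef) (hRβ : Rβ.PosDef) (hRv : Rv.PosDef) (hTv : Tv.PosDef)
    (hSy : Sy.PosDef) (hSyHalf : SyHalf.PosDef) (hsq : SyHalf * SyHalf = Sy)
    (lam : ℝ) (hlam : 0 ≤ lam)
    (Fb Fc : ℕ → Matrix (Fin n) (Fin n) ℝ)
    (hwp : ((1 : Matrix (Fin n) (Fin n) ℝ) - lam • (SyHalf⁻¹ * Rβ⁻¹ * SyHalf⁻¹)).PosSemidef)
    (A B : Matrix (Fin n ⊕ Fin n) (Fin n ⊕ Fin n) ℝ)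
    (hA : A = fromBlocks 1 0 1 1) (hB : B = 1)
    (R : Matrix (Fin n ⊕ Fin n) (Fin n ⊕ Fin n) ℝ) (hR : R = fromBlocks Rα 0 0 Rβ)
    (Q N : ℕ → Matrix (Fin n ⊕ Fin n) (Fin n ⊕ Fin n) ℝ)
    (hQ : ∀ t, Q t = fromBlocks
      (Rv + lam • ((Fb t)ᵀ * Sy⁻¹ * Fb t)) (lam • ((Fb t)ᵀ * Sy⁻¹ * Fc t))
      (lam • ((Fc t)ᵀ * Sy⁻¹ * Fb t)) (lam • ((Fc t)ᵀ * Sy⁻¹ * Fc t)))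
    (hN : ∀ t, N t = fromBlocks
      0 (-(lam • ((Fb t)ᵀ * Sy⁻¹)))
      0 (-(lam • ((Fc t)ᵀ * Sy⁻¹))))
    (P H G : ℕ → Matrix (Fin n ⊕ Fin n) (Fin n ⊕ Fin n) ℝ)
    (hH : ∀ t, H t = R + Bᵀ * P (t + 1) * B)
    (hG : ∀ t, G t = N t + Aᵀ * P (t + 1) * B)
    (hPT : P T = fromBlocks Tv 0 0 0)
    (hPrec : ∀ t < T, P t = Q t + Aᵀ * P (t + 1) * A - G t * (H t)⁻¹ * (G t)ᵀ) :
    (∀ t < T, (H t).PosDef ∧ IsUnit (H t)) ∧ (∀ t ≤ T, (P t).PosSemidef) := by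
  have hRpd : R.PosDef := hR ▸ hRα.fromBlocks_diagonal hRβ
  have hRinv : R⁻¹ = fromBlocks Rα⁻¹ 0 0 Rβ⁻¹ := by
    rw [hR]
    refine inv_eq_right_inv ?_
    simp [fromBlocks_multiply, mul_nonsing_inv _ ((isUnit_iff_isUnit_det _).1 hRα.isUnit),
      mul_nonsing_inv _ ((isUnit_iff_isUnit_det _).1 hRβ.isUnit)]
  have hSyinv : Sy⁻¹ = SyHalf⁻¹ * SyHalf⁻¹ := by rw [← hsq, Matrix.mul_inv_rev]
  have hHalfT : (SyHalf⁻¹)ᵀ = SyHalf⁻¹ := by simpa using hSyHalf.inv.isHermitian.eq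
  have hstage (t : ℕ) : (Q t - N t * R⁻¹ * (N t)ᵀ).PosSemidef := by
    have hschur : Q t - N t * R⁻¹ * (N t)ᵀ = fromBlocks Rv 0 0 0 +
        lam • ((SyHalf⁻¹ * fromCols (Fb t) (Fc t))ᴴ *
          (1 - lam • (SyHalf⁻¹ * Rβ⁻¹ * SyHalf⁻¹)) *
            (SyHalf⁻¹ * fromCols (Fb t) (Fc t))) := by
      rw [hQ, hN, hRinv, hSyinv, mul_fromCols, conjTranspose_fromCols_eq_fromRows_conjTranspose,
        fromRows_mul, fromRows_mul_fromCols, fromBlocks_smul]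
      simp [fromBlocks_multiply, fromBlocks_transpose, fromBlocks_add, sub_eq_add_neg,
        fromBlocks_neg, transpose_mul, hHalfT, Matrix.mul_assoc, Matrix.mul_add,
        Matrix.add_mul, smul_smul, add_assoc]
    rw [hschur]
    exact hRv.posSemidef_fromBlocks_zero.add ((hwp.conjTranspose_mul_mul_same _).smul hlam)
  have hP : ∀ t ≤ T, (P t).PosSemidef := fun t ht => by
    induction ht using Nat.decreasingInduction with
    | self => exact hPT ▸ hTv.posSemidef_fromBlocks_zero
    | of_succ t ht ih =>
      rw [hPrec t ht, hG, hH]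
      exact ih.riccati_step hRpd (hstage t)
  refine ⟨fun t ht => ?_, hP⟩
  have hHpd : (H t).PosDef := by
    rw [hH]
    exact hRpd.add_posSemidef (by simpa using (hP (t + 1) ht).conjTranspose_mul_mul_same B)
  exact ⟨hHpd, hHpd.isUnit⟩
end

section
/- Let the well-posedness condition I_n − λ(Σ_y²)^{-1/2} R_β^{-1} (Σ_y²)^{-1/2} ⪰ 0 hold. Then for every t ∈ {0,…,T−1} the 4n×4n block matrix [[Q_t, N_t],[N_tᵀ, R]] is positive semidefinite; equivalently, (1/2)xᵀQ_t x + (1/2)uᵀR u + xᵀN_t u ≥ 0 for all x, u ∈ ℝ^{2n}. -/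
open Matrix

/-- A block diagonal matrix with positive semidefinite blocks is positive semidefinite. -/
theorem posSemidef_fromBlocks_diagonal {m k : Type*} [Fintype m] [Fintype k]
    {A : Matrix m m ℝ} {D : Matrix k k ℝ} (hA : A.PosSemidef) (hD : D.PosSemidef) :
    (fromBlocks A 0 0 D).PosSemidef := by
  refine PosSemidef.of_dotProduct_mulVec_nonneg ?_ fun x => ?_
  · exact hA.isHermitian.fromBlocks (by simp) hD.isHermitian
  · have h₁ := hA.dotProduct_mulVec_nonneg (x ∘ Sum.inl)
    have h₂ := hD.dotProduct_mulVec_nonneg (x ∘ Sum.inr)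
    simp only [fromBlocks_mulVec, dotProduct, Fintype.sum_sum_type, Sum.elim_inl, Sum.elim_inr,
      zero_mulVec, add_zero, zero_add, Pi.star_apply, Function.comp_apply] at h₁ h₂ ⊢
    exact add_nonneg h₁ h₂

/-- For positive definite `A` and `B`, if `c • A⁻¹ ≤ B` in the Loewner order then
`c • B⁻¹ ≤ A`. -/
theorem posSemidef_sub_smul_inv_of_posSemidef_sub_smul_inv {m : Type*} [Fintype m]
    [DecidableEq m] {A B : Matrix m m ℝ} (hA : A.PosDef) (hB : B.PosDef) {c : ℝ} (hc : 0 ≤ c)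
    (h : (B - c • A⁻¹).PosSemidef) : (A - c • B⁻¹).PosSemidef := by
  have hinv (M : Matrix m m ℝ) :
      (√c • (1 : Matrix m m ℝ)) * M * (√c • (1 : Matrix m m ℝ)) = c • M := by
    simp [smul_smul, Real.mul_self_sqrt hc]
  have hherm : (√c • (1 : Matrix m m ℝ))ᴴ = √c • (1 : Matrix m m ℝ) := by simp
  let _ := hA.isUnit.invertible
  let _ := hB.isUnit.invertible
  have h₁ := PosDef.fromBlocks₁₁ (√c • (1 : Matrix m m ℝ)) B hA
  have h₂ := PosDef.fromBlocks₂₂ A (√c • (1 : Matrix m m ℝ)) hB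
  rw [hherm, hinv] at h₁ h₂
  exact h₂.mp (h₁.mpr h)

/-- **Nonnegativity of the augmented stage cost.**
Under the well-posedness condition, for every `t < T` the block matrix
`[[Q_t, N_t],[N_tᵀ, R]]` is positive semidefinite; equivalently, the stage cost
`(1/2)xᵀQ_t x + (1/2)uᵀR u + xᵀN_t u` is nonnegative for all `x`, `u`. -/
theorem deceptive_lq_stage_cost_nonneg
    (n T : ℕ) (hn : 1 ≤ n) (hT : 1 ≤ T)
    (Rα Rβ Rv Tv Sy SyHalf : Matrix (Fin n) (Fin n) ℝ)
    (hRα : Rα.PosDef) (hRβ : Rβ.PosDef) (hRv : Rv.PosDef) (hTv : Tv.PosDef)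
    (hSy : Sy.PosDef) (hSyHalf : SyHalf.PosDef) (hsq : SyHalf * SyHalf = Sy)
    (lam : ℝ) (hlam : 0 ≤ lam)
    (Fb Fc : ℕ → Matrix (Fin n) (Fin n) ℝ)
    (hwp : ((1 : Matrix (Fin n) (Fin n) ℝ) - lam • (SyHalf⁻¹ * Rβ⁻¹ * SyHalf⁻¹)).PosSemidef)
    (R : Matrix (Fin n ⊕ Fin n) (Fin n ⊕ Fin n) ℝ) (hR : R = fromBlocks Rα 0 0 Rβ)
    (Q N : ℕ → Matrix (Fin n ⊕ Fin n) (Fin n ⊕ Fin n) ℝ)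
    (hQ : ∀ t, Q t = fromBlocks
      (Rv + lam • ((Fb t)ᵀ * Sy⁻¹ * Fb t)) (lam • ((Fb t)ᵀ * Sy⁻¹ * Fc t))
      (lam • ((Fc t)ᵀ * Sy⁻¹ * Fb t)) (lam • ((Fc t)ᵀ * Sy⁻¹ * Fc t)))
    (hN : ∀ t, N t = fromBlocks
      0 (-(lam • ((Fb t)ᵀ * Sy⁻¹)))
      0 (-(lam • ((Fc t)ᵀ * Sy⁻¹)))) :
    ∀ t < T, (fromBlocks (Q t) (N t) (N t)ᵀ R).PosSemidef ∧
      ∀ x u : Fin n ⊕ Fin n → ℝ,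
        0 ≤ (1/2) * (x ⬝ᵥ (Q t) *ᵥ x) + (1/2) * (u ⬝ᵥ R *ᵥ u) + x ⬝ᵥ (N t) *ᵥ u := by
  have hSyInv : Sy⁻¹ᵀ = Sy⁻¹ := by
    simpa [IsHermitian, conjTranspose_eq_transpose_of_trivial] using hSy.inv.isHermitian
  have hdet : IsUnit SyHalf.det := (isUnit_iff_isUnit_det _).mp hSyHalf.isUnit
  have hRβ_le_Sy : (Sy - lam • Rβ⁻¹).PosSemidef := by
    have h := hwp.conjTranspose_mul_mul_same SyHalf
    have hcancel : SyHalf * (SyHalf⁻¹ * Rβ⁻¹ * SyHalf⁻¹) * SyHalf = Rβ⁻¹ := by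
      rw [Matrix.mul_assoc SyHalf⁻¹, mul_nonsing_inv_cancel_left _ _ hdet,
        nonsing_inv_mul_cancel_right _ _ hdet]
    rwa [hSyHalf.isHermitian.eq, Matrix.mul_sub, Matrix.sub_mul, Matrix.mul_one, hsq,
      Matrix.mul_smul, Matrix.smul_mul, hcancel] at h
  have hSy_le_Rβ : (Rβ - lam • Sy⁻¹).PosSemidef :=
    posSemidef_sub_smul_inv_of_posSemidef_sub_smul_inv hRβ hSy hlam hRβ_le_Sy
  intro t _
  have hpsd : (fromBlocks (Q t) (N t) (N t)ᵀ R).PosSemidef := by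
    let G := fromCols (fromCols (Fb t) (Fc t))
      (fromCols (0 : Matrix (Fin n) (Fin n) ℝ) (-1 : Matrix (Fin n) (Fin n) ℝ))
    have hdecomp : fromBlocks (Q t) (N t) (N t)ᵀ R =
        fromBlocks (fromBlocks Rv 0 0 0) 0 0 (fromBlocks Rα 0 0 (Rβ - lam • Sy⁻¹)) +
          lam • (Gᴴ * Sy⁻¹ * G) := by
      ext ((i | i) | (i | i)) ((j | j) | (j | j)) <;>
        simp [G, hQ, hN, hR, transpose_fromCols, fromRows_mul, fromBlocks_transpose, hSyInv]
    rw [hdecomp]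
    exact (posSemidef_fromBlocks_diagonal
      (posSemidef_fromBlocks_diagonal hRv.posSemidef PosSemidef.zero)
      (posSemidef_fromBlocks_diagonal hRα.posSemidef hSy_le_Rβ)).add
      ((hSy.inv.posSemidef.conjTranspose_mul_mul_same G).smul hlam)
  refine ⟨hpsd, fun x u => ?_⟩
  have h := hpsd.dotProduct_mulVec_nonneg (Sum.elim x u)
  have hcross : u ⬝ᵥ (N t)ᵀ *ᵥ x = x ⬝ᵥ N t *ᵥ u := by
    rw [mulVec_transpose, dotProduct_comm, dotProduct_mulVec]
  simp only [star_trivial, fromBlocks_mulVec, Sum.elim_comp_inl, Sum.elim_comp_inr,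
    sumElim_dotProduct_sumElim, dotProduct_add, hcross] at h
  linarith
end

section
/- Let Q, P ∈ ℝ^{d×d}, N ∈ ℝ^{d×m}, R ∈ ℝ^{m×m}, A ∈ ℝ^{d×d}, B ∈ ℝ^{d×m}. Assume the block matrix [[Q, N],[Nᵀ, R]] is positive semidefinite, R is symmetric positive definite, and P is symmetric positive semidefinite. Then H := R + BᵀPB is symmetric positive definite, and Q + AᵀPA − (N + AᵀPB) H^{-1} (N + AᵀPB)ᵀ is positive semidefinite. -/
open Matrix

/-- **One-step propagation of positive semidefiniteness in the Riccati recursion.**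
If `[[Q, N],[Nᵀ, R]] ⪰ 0`, `R ≻ 0` is symmetric, and `P ⪰ 0` is symmetric, then
`H := R + BᵀPB` is symmetric positive definite and
`Q + AᵀPA − (N + AᵀPB) H⁻¹ (N + AᵀPB)ᵀ ⪰ 0`. -/
theorem riccati_step_posSemidef
    (d m : ℕ)
    (Q P : Matrix (Fin d) (Fin d) ℝ) (N : Matrix (Fin d) (Fin m) ℝ)
    (R : Matrix (Fin m) (Fin m) ℝ)
    (A : Matrix (Fin d) (Fin d) ℝ) (B : Matrix (Fin d) (Fin m) ℝ)
    (hblock : (fromBlocks Q N Nᵀ R).PosSemidef)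
    (hR : R.PosDef) (hP : P.PosSemidef) :
    (R + Bᵀ * P * B).PosDef ∧
    (Q + Aᵀ * P * A -
      (N + Aᵀ * P * B) * (R + Bᵀ * P * B)⁻¹ * (N + Aᵀ * P * B)ᵀ).PosSemidef := by
  have hH : (R + Bᵀ * P * B).PosDef := by
    simpa only [conjTranspose_eq_transpose_of_trivial] using
      hR.add_posSemidef (hP.conjTranspose_mul_mul_same B)
  refine ⟨hH, ?_⟩
  have hPt : Pᵀ = P := by
    simpa only [conjTranspose_eq_transpose_of_trivial] using hP.isHermitian.eq
  have hsum := hblock.add (hP.conjTranspose_mul_mul_same (fromCols A B))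
  have heq : fromBlocks Q N Nᵀ R + (fromCols A B)ᴴ * P * fromCols A B =
      fromBlocks (Q + Aᵀ * P * A) (N + Aᵀ * P * B) (N + Aᵀ * P * B)ᴴ (R + Bᵀ * P * B) := by
    simp only [conjTranspose_eq_transpose_of_trivial, transpose_fromCols, fromRows_mul,
      mul_fromCols, fromCols_fromRows_eq_fromBlocks, fromBlocks_add, transpose_add,
      transpose_mul, transpose_transpose, hPt, Matrix.mul_assoc]
  rw [heq] at hsum
  have : Invertible (R + Bᵀ * P * B) := hH.isUnit.invertible
  simpa only [conjTranspose_eq_transpose_of_trivial] using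
    (PosDef.fromBlocks₂₂ _ _ hH).mp hsum
end

section
/- Let n = 1 and let λ = 0 or λ = R_β Σ_y². Then the solution (P_t, s_t) of the backward recursions P_t = Q_t + AᵀP_{t+1}A − G_t H_t^{-1} G_tᵀ and s_t = q_t + Aᵀs_{t+1} − G_t H_t^{-1}(r_t + Bᵀs_{t+1}), with terminal conditions P_T = [[T_v, 0],[0, 0]] and s_T = (−T_v v̄_T, 0)ᵀ, has the sparsity pattern P_t = [[ρ_t, 0],[0, 0]] and s_t = (η_t, 0)ᵀ for all t ∈ {0,…,T}, where the scalars ρ_t, η_t satisfy ρ_T = T_v, η_T = −T_v v̄_T, ρ_t = R_v + R_α ρ_{t+1}/(R_α + ρ_{t+1}), and η_t = −R_v v̄_t + R_α η_{t+1}/(R_α + ρ_{t+1}); in particular ρ_t > 0 for all t, so the recursion is well defined. -/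
open Matrix

/-- One step of the matrix recursion, with `κ = λ / Σ_y²`: the condition `κ ^ 2 = κ * Rβ` makes the
cost terms cancel against the correction term, leaving only the `(0, 0)` entry. -/
theorem riccati_step {Rα Rβ ρ κ : ℝ} (hα : Rα + ρ ≠ 0) (hβ : Rβ ≠ 0) (hκ : κ ^ 2 = κ * Rβ)
    (Rv b c : ℝ) :
    !![Rv + κ * b ^ 2, κ * b * c; κ * c * b, κ * c ^ 2]
        + !![1, 0; 1, 1]ᵀ * !![ρ, 0; 0, 0] * !![1, 0; 1, 1]
        - !![ρ, -(κ * b); 0, -(κ * c)] * !![(Rα + ρ)⁻¹, 0; 0, Rβ⁻¹]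
          * !![ρ, -(κ * b); 0, -(κ * c)]ᵀ
      = !![Rv + Rα * ρ / (Rα + ρ), 0; 0, 0] := by
  ext i j
  fin_cases i <;> fin_cases j <;>
    simp [Matrix.mul_apply, Matrix.vecMul, dotProduct, Fin.sum_univ_two] <;> field_simp
  · linear_combination (-(Rα + ρ) * b ^ 2) * hκ
  · linear_combination (-b * c) * hκ
  · linear_combination (-b * c) * hκ
  · linear_combination (-c ^ 2) * hκ

/-- One step of the vector recursion, under the same cancellation condition as `riccati_step`. -/
theorem affine_step {Rα Rβ ρ κ : ℝ} (hα : Rα + ρ ≠ 0) (hβ : Rβ ≠ 0) (hκ : κ ^ 2 = κ * Rβ)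
    (w b c d η : ℝ) :
    ![w + κ * b * d, κ * c * d] + !![1, 0; 1, 1]ᵀ *ᵥ ![η, 0]
        - (!![ρ, -(κ * b); 0, -(κ * c)] * !![(Rα + ρ)⁻¹, 0; 0, Rβ⁻¹])
          *ᵥ (![0, -(κ * d)] + ![η, 0])
      = ![w + Rα * η / (Rα + ρ), 0] := by
  ext i
  fin_cases i <;> simp <;> field_simp
  · linear_combination (-(Rα + ρ) * b * d) * hκ
  · linear_combination (-c * d) * hκ

/-- **Sparsity pattern of the backward recursion in the one-dimensional case.**
For `n = 1` and `λ = 0` or `λ = R_β Σ_y²`, the solution `(P_t, s_t)` of the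
backward recursions has the sparsity pattern `P_t = [[ρ_t, 0],[0,0]]`,
`s_t = (η_t, 0)ᵀ`, where `ρ_T = T_v`, `η_T = −T_v v̄_T`,
`ρ_t = R_v + R_α ρ_{t+1}/(R_α + ρ_{t+1})`,
`η_t = −R_v v̄_t + R_α η_{t+1}/(R_α + ρ_{t+1})`, and `ρ_t > 0` for all `t`. -/
theorem one_dim_sparsity_pattern
    (T : ℕ) (hT : 1 ≤ T)
    (Rα Rβ Rv Tv Sy : ℝ)
    (hRα : 0 < Rα) (hRβ : 0 < Rβ) (hRv : 0 < Rv) (hTv : 0 < Tv) (hSy : 0 < Sy)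
    (lam : ℝ) (hlam : lam = 0 ∨ lam = Rβ * Sy)
    (Fb Fc fd vbar : ℕ → ℝ)
    (A B R : Matrix (Fin 2) (Fin 2) ℝ)
    (hA : A = !![1, 0; 1, 1]) (hB : B = 1) (hR : R = !![Rα, 0; 0, Rβ])
    (Q N : ℕ → Matrix (Fin 2) (Fin 2) ℝ)
    (hQ : ∀ t, Q t = !![Rv + lam * (Fb t)^2 / Sy, lam * Fb t * Fc t / Sy;
                        lam * Fc t * Fb t / Sy, lam * (Fc t)^2 / Sy])
    (hN : ∀ t, N t = !![0, -(lam * Fb t / Sy); 0, -(lam * Fc t / Sy)])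
    (q r : ℕ → Fin 2 → ℝ)
    (hq : ∀ t, q t = ![-(Rv * vbar t) + lam * Fb t * fd t / Sy, lam * Fc t * fd t / Sy])
    (hr : ∀ t, r t = ![0, -(lam * fd t / Sy)])
    (P H G : ℕ → Matrix (Fin 2) (Fin 2) ℝ) (s : ℕ → Fin 2 → ℝ)
    (hH : ∀ t, H t = R + Bᵀ * P (t + 1) * B)
    (hG : ∀ t, G t = N t + Aᵀ * P (t + 1) * B)
    (hPT : P T = !![Tv, 0; 0, 0]) (hsT : s T = ![-(Tv * vbar T), 0])
    (hPrec : ∀ t < T, P t = Q t + Aᵀ * P (t + 1) * A - G t * (H t)⁻¹ * (G t)ᵀ)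
    (hsrec : ∀ t < T,
      s t = q t + Aᵀ *ᵥ s (t + 1) - (G t * (H t)⁻¹) *ᵥ (r t + Bᵀ *ᵥ s (t + 1))) :
    ∃ ρ η : ℕ → ℝ,
      ρ T = Tv ∧ η T = -(Tv * vbar T) ∧
      (∀ t < T, ρ t = Rv + Rα * ρ (t + 1) / (Rα + ρ (t + 1)) ∧
                η t = -(Rv * vbar t) + Rα * η (t + 1) / (Rα + ρ (t + 1))) ∧
      (∀ t ≤ T, P t = !![ρ t, 0; 0, 0] ∧ s t = ![η t, 0] ∧ 0 < ρ t) := by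
  set κ := lam / Sy with hκdef
  have hκ : κ ^ 2 = κ * Rβ := by
    rcases hlam with h | h
    · simp [hκdef, h]
    · have : κ = Rβ := by rw [hκdef, h]; field_simp
      rw [this]; ring
  have step : ∀ t < T, ∀ ρ η : ℝ, 0 < ρ → P (t + 1) = !![ρ, 0; 0, 0] → s (t + 1) = ![η, 0] →
      P t = !![Rv + Rα * ρ / (Rα + ρ), 0; 0, 0] ∧
      s t = ![-(Rv * vbar t) + Rα * η / (Rα + ρ), 0] := by
    intro t ht ρ η hρ hP hs
    have hα : Rα + ρ ≠ 0 := by positivity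
    have hHinv : (H t)⁻¹ = !![(Rα + ρ)⁻¹, 0; 0, Rβ⁻¹] := by
      apply Matrix.inv_eq_right_inv
      rw [hH, hR, hB, hP]
      ext i j
      fin_cases i <;> fin_cases j <;> simp [Matrix.mul_apply, Fin.sum_univ_two, hα, hRβ.ne']
    have hGt : G t = !![ρ, -(κ * Fb t); 0, -(κ * Fc t)] := by
      rw [hG, hN, hA, hB, hP]
      ext i j
      fin_cases i <;> fin_cases j <;> simp [Matrix.mul_apply, Fin.sum_univ_two, κ] <;> ring
    have hQt : Q t = !![Rv + κ * Fb t ^ 2, κ * Fb t * Fc t; κ * Fc t * Fb t, κ * Fc t ^ 2] := by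
      rw [hQ]
      ext i j
      fin_cases i <;> fin_cases j <;> simp [κ] <;> ring
    have hqt : q t = ![-(Rv * vbar t) + κ * Fb t * fd t, κ * Fc t * fd t] := by
      rw [hq]
      ext i
      fin_cases i <;> simp [κ] <;> ring
    have hrt : r t = ![0, -(κ * fd t)] := by
      rw [hr]
      ext i
      fin_cases i <;> simp [κ]; ring
    constructor
    · rw [hPrec t ht, hHinv, hGt, hQt, hA, hP]
      exact riccati_step hα hRβ.ne' hκ _ _ _
    · rw [hsrec t ht, hHinv, hGt, hqt, hrt, hA, hB, hs, Matrix.transpose_one, Matrix.one_mulVec]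
      exact affine_step hα hRβ.ne' hκ _ _ _ _ _
  have sparse : ∀ t ≤ T, P t = !![P t 0 0, 0; 0, 0] ∧ s t = ![s t 0, 0] ∧ 0 < P t 0 0 := by
    intro t ht
    induction ht using Nat.decreasingInduction with
    | self => simp [hPT, hsT, hTv]
    | of_succ t ht ih =>
      obtain ⟨hP, hs, hpos⟩ := ih
      obtain ⟨hP', hs'⟩ := step t ht _ _ hpos hP hs
      rw [hP', hs']
      refine ⟨by simp, by simp, ?_⟩
      simp only [Matrix.of_apply, Matrix.cons_val_zero]
      positivity
  refine ⟨fun t => P t 0 0, fun t => s t 0, by simp [hPT], by simp [hsT], fun t ht => ?_, sparse⟩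
  obtain ⟨hP, hs, hpos⟩ := sparse (t + 1) ht
  obtain ⟨hP', hs'⟩ := step t ht _ _ hpos hP hs
  exact ⟨by simpa using congrFun (congrFun hP' 0) 0, by simpa using congrFun hs' 0⟩
end

section
/- Let n = 1 and let λ = 0 or λ = R_β Σ_y². With (P_t, s_t) the solution of the backward recursions, write P_{t+1} = [[ρ_{t+1}, 0],[0, 0]] and s_{t+1} = (η_{t+1}, 0)ᵀ. Then for every state x_t = (v_t, p_t)ᵀ ∈ ℝ², the optimal control u_t^* := −H_t^{-1}(G_tᵀ x_t + r_t + Bᵀ s_{t+1}) has components α_t^* = −(ρ_{t+1} v_t + η_{t+1})/(R_α + ρ_{t+1}) and β_t^* = (λ/(R_β Σ_y²)) (F_t^b v_t + F_t^c p_t + f_t^d). In particular, if λ = 0 then β_t^* = 0; if λ = R_β Σ_y² then β_t^* = F_t^b v_t + F_t^c p_t + f_t^d; and the component α_t^* is given by the same formula in both cases. -/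
open Matrix

/-- **Closed form of the optimal deceptive control in the one-dimensional case.**
For `n = 1` and `λ = 0` or `λ = R_β Σ_y²`, with `P_{t+1} = [[ρ,0],[0,0]]`,
`s_{t+1} = (η,0)ᵀ` (`ρ > 0`), the optimal control
`u_t^* = −H_t⁻¹(G_tᵀ x_t + r_t + Bᵀ s_{t+1})` at state `x_t = (v,p)ᵀ` has components
`α_t^* = −(ρ v + η)/(R_α + ρ)` and `β_t^* = (λ/(R_β Σ_y²))(F_t^b v + F_t^c p + f_t^d)`;
in particular `β_t^* = 0` when `λ = 0`, `β_t^* = F_t^b v + F_t^c p + f_t^d` when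
`λ = R_β Σ_y²`, and `α_t^*` is given by the same formula in both cases. -/
theorem one_dim_optimal_control
    (T : ℕ) (hT : 1 ≤ T) (t : ℕ) (ht : t < T)
    (Rα Rβ Rv Tv Sy : ℝ)
    (hRα : 0 < Rα) (hRβ : 0 < Rβ) (hRv : 0 < Rv) (hTv : 0 < Tv) (hSy : 0 < Sy)
    (lam : ℝ) (hlam : lam = 0 ∨ lam = Rβ * Sy)
    (Fb Fc fd vbar : ℕ → ℝ)
    (A B R : Matrix (Fin 2) (Fin 2) ℝ)
    (hA : A = !![1, 0; 1, 1]) (hB : B = 1) (hR : R = !![Rα, 0; 0, Rβ])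
    (Q N : ℕ → Matrix (Fin 2) (Fin 2) ℝ)
    (hQ : ∀ k, Q k = !![Rv + lam * (Fb k)^2 / Sy, lam * Fb k * Fc k / Sy;
                        lam * Fc k * Fb k / Sy, lam * (Fc k)^2 / Sy])
    (hN : ∀ k, N k = !![0, -(lam * Fb k / Sy); 0, -(lam * Fc k / Sy)])
    (q r : ℕ → Fin 2 → ℝ)
    (hq : ∀ k, q k = ![-(Rv * vbar k) + lam * Fb k * fd k / Sy, lam * Fc k * fd k / Sy])
    (hr : ∀ k, r k = ![0, -(lam * fd k / Sy)])
    (P H G : ℕ → Matrix (Fin 2) (Fin 2) ℝ) (s : ℕ → Fin 2 → ℝ)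
    (hH : ∀ k, H k = R + Bᵀ * P (k + 1) * B)
    (hG : ∀ k, G k = N k + Aᵀ * P (k + 1) * B)
    (hPT : P T = !![Tv, 0; 0, 0]) (hsT : s T = ![-(Tv * vbar T), 0])
    (hPrec : ∀ k < T, P k = Q k + Aᵀ * P (k + 1) * A - G k * (H k)⁻¹ * (G k)ᵀ)
    (hsrec : ∀ k < T,
      s k = q k + Aᵀ *ᵥ s (k + 1) - (G k * (H k)⁻¹) *ᵥ (r k + Bᵀ *ᵥ s (k + 1)))
    (ρ η : ℝ) (hρ : 0 < ρ)
    (hPsp : P (t + 1) = !![ρ, 0; 0, 0]) (hssp : s (t + 1) = ![η, 0])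
    (v p : ℝ) (x : Fin 2 → ℝ) (hx : x = ![v, p])
    (u : Fin 2 → ℝ)
    (hu : u = -((H t)⁻¹ *ᵥ ((G t)ᵀ *ᵥ x + r t + Bᵀ *ᵥ s (t + 1)))) :
    u 0 = -((ρ * v + η) / (Rα + ρ)) ∧
    u 1 = lam / (Rβ * Sy) * (Fb t * v + Fc t * p + fd t) ∧
    (lam = 0 → u 1 = 0) ∧
    (lam = Rβ * Sy → u 1 = Fb t * v + Fc t * p + fd t) := by
  have hRαρ : Rα + ρ ≠ 0 := (add_pos hRα hρ).ne'
  have hHinv : (H t)⁻¹ = !![(Rα + ρ)⁻¹, 0; 0, Rβ⁻¹] := by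
    refine Matrix.inv_eq_right_inv ?_
    rw [hH, hR, hB, hPsp]
    ext i j
    fin_cases i <;> fin_cases j <;> simp [hRαρ, hRβ.ne']
  have hGt : (G t)ᵀ = !![ρ, 0; -(lam * Fb t / Sy), -(lam * Fc t / Sy)] := by
    rw [hG, hN, hA, hB, hPsp]
    ext i j
    fin_cases i <;> fin_cases j <;> simp [Matrix.mul_apply, Fin.sum_univ_two]
  have hα : u 0 = -((ρ * v + η) / (Rα + ρ)) := by
    rw [hu, hHinv, hGt, hr, hB, hssp, hx]
    simp [vecHead, vecTail]
    field_simp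
  have hβ : u 1 = lam / (Rβ * Sy) * (Fb t * v + Fc t * p + fd t) := by
    rw [hu, hHinv, hGt, hr, hB, hssp, hx]
    simp [vecHead, vecTail]
    field_simp
    ring
  refine ⟨hα, hβ, fun h => ?_, fun h => ?_⟩
  · rw [hβ, h, zero_div, zero_mul]
  · rw [hβ, h, div_self (mul_pos hRβ hSy).ne', one_mul]
end

section
/- Let X be an ℝⁿ-valued Gaussian random vector with law N(0, Σ_X), where Σ_X ∈ ℝ^{n×n} is symmetric positive definite with symmetric positive definite square root Σ_X^{1/2}, and let A ∈ ℝ^{n×n} be any matrix. Then for every t > 0, P(XᵀAX − E[XᵀAX] ≥ t) ≤ exp{ −(1/8) min( t²/‖Σ_X^{1/2} A Σ_X^{1/2}‖_F², t/‖Σ_X^{1/2} A Σ_X^{1/2}‖₂ ) }. -/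
open Matrix MeasureTheory ProbabilityTheory

/-- A measure `μ` on `ℝ^d` is the Gaussian distribution `N(m, S)` iff every linear
functional pushes it to the corresponding one-dimensional Gaussian (Cramér–Wold). -/
def IsGaussianLaw {d : Type*} [Fintype d] (μ : Measure (d → ℝ))
    (m : d → ℝ) (S : Matrix d d ℝ) : Prop :=
  ∀ a : d → ℝ, μ.map (fun x => a ⬝ᵥ x) =
    gaussianReal (a ⬝ᵥ m) (Real.toNNReal (a ⬝ᵥ S *ᵥ a))

/-- The Frobenius norm of a real matrix. -/
noncomputable def frobNorm {ι : Type*} [Fintype ι] (M : Matrix ι ι ℝ) : ℝ :=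
  Real.sqrt (∑ i, ∑ j, (M i j) ^ 2)

/-- The operator (spectral) 2-norm of a real matrix. -/
noncomputable def specNorm {ι : Type*} [Fintype ι] [DecidableEq ι] (M : Matrix ι ι ℝ) : ℝ :=
  ‖Matrix.toEuclideanCLM (𝕜 := ℝ) M‖


section Scalar

lemma inv_one_sub_le_exp_add_sq {x : ℝ} (hx : |x| ≤ 1 / 2) :
    (1 - x)⁻¹ ≤ Real.exp (x + x ^ 2) := by
  obtain ⟨h1, h2⟩ := abs_le.mp hx
  rw [inv_le_iff_one_le_mul₀ (by linarith)]
  rcases le_total 0 x with h0 | h0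
  · have h := Real.quadratic_le_exp_of_nonneg (x := x + x ^ 2) (by positivity)
    have : 1 ≤ (1 - x) * (1 + (x + x ^ 2) + (x + x ^ 2) ^ 2 / 2) := by
      have : 0 ≤ x ^ 2 * ((1 - x ^ 2) * (1 + x) - 2 * x) := by
        refine mul_nonneg (sq_nonneg x) ?_
        nlinarith [mul_nonneg h0 (sub_nonneg.mpr h2), mul_nonneg (mul_nonneg h0 h0) (sub_nonneg.mpr h2)]
      nlinarith
    nlinarith
  · have h := Real.add_one_le_exp (x + x ^ 2)
    have : 0 ≤ x ^ 2 * (-x) := by apply mul_nonneg (sq_nonneg x); linarith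
    nlinarith

lemma gaussianPDFReal_zero_one_mul_exp_mul_sq (c x : ℝ) :
    gaussianPDFReal 0 1 x * Real.exp (c * x ^ 2) =
      (√(2 * Real.pi))⁻¹ * Real.exp (-((1 - 2 * c) / 2) * x ^ 2) := by
  simp only [gaussianPDFReal, NNReal.coe_one, mul_one, sub_zero]
  rw [mul_assoc, ← Real.exp_add]
  congr 2
  ring

lemma integrable_exp_mul_sq_gaussianReal {c : ℝ} (hc : c < 1 / 2) :
    Integrable (fun x => Real.exp (c * x ^ 2)) (gaussianReal 0 1) := by
  rw [gaussianReal_of_var_ne_zero 0 one_ne_zero,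
    integrable_withDensity_iff_integrable_smul' (measurable_gaussianPDF 0 1)
      (ae_of_all _ fun _ => gaussianPDF_lt_top)]
  simp only [toReal_gaussianPDF, smul_eq_mul, gaussianPDFReal_zero_one_mul_exp_mul_sq]
  exact (integrable_exp_neg_mul_sq (by linarith)).const_mul _

lemma integral_exp_mul_sq_gaussianReal {c : ℝ} (hc : c < 1 / 2) :
    ∫ x, Real.exp (c * x ^ 2) ∂(gaussianReal 0 1) = √((1 - 2 * c)⁻¹) := by
  rw [integral_gaussianReal_eq_integral_smul one_ne_zero]
  simp only [smul_eq_mul, gaussianPDFReal_zero_one_mul_exp_mul_sq]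
  rw [integral_const_mul, integral_gaussian, ← Real.sqrt_inv, ← Real.sqrt_mul (by positivity)]
  congr 1
  have : 1 - 2 * c ≠ 0 := by linarith
  field_simp

lemma integral_exp_mul_sq_gaussianReal_le {c : ℝ} (hc : |c| ≤ 1 / 4) :
    ∫ x, Real.exp (c * x ^ 2) ∂(gaussianReal 0 1) ≤ Real.exp (c + 2 * c ^ 2) := by
  have h := abs_le.mp hc
  rw [integral_exp_mul_sq_gaussianReal (by linarith)]
  refine Real.sqrt_le_iff.mpr ⟨(Real.exp_pos _).le, ?_⟩
  have hx : |2 * c| ≤ 1 / 2 := by rw [abs_mul, abs_two]; linarith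
  refine (inv_one_sub_le_exp_add_sq hx).trans_eq ?_
  rw [← Real.exp_nat_mul]
  congr 1
  push_cast
  ring

lemma integral_sq_gaussianReal : ∫ x, x ^ 2 ∂(gaussianReal 0 1) = 1 := by
  have h := variance_fun_id_gaussianReal (μ := 0) (v := 1)
  rw [variance_eq_integral (by fun_prop)] at h
  simpa using h

/-- Optimizing the Chernoff exponent `-θ t + 2 θ² F²` over `0 ≤ θ ≤ 1 / (4 s)`. -/
lemma exists_chernoff_parameter {F s t : ℝ} (hF : 0 < F) (hs : 0 < s) (ht : 0 < t) :
    ∃ θ, 0 ≤ θ ∧ θ * s ≤ 1 / 4 ∧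
      -θ * t + 2 * θ ^ 2 * F ^ 2 ≤ -(1 / 8) * min (t ^ 2 / F ^ 2) (t / s) := by
  rcases le_total (t / (4 * F ^ 2)) (1 / (4 * s)) with h | h
  · refine ⟨t / (4 * F ^ 2), by positivity, ?_, ?_⟩
    · calc t / (4 * F ^ 2) * s ≤ 1 / (4 * s) * s := by gcongr
        _ = 1 / 4 := by field_simp
    · have := min_le_left (t ^ 2 / F ^ 2) (t / s)
      have e : -(t / (4 * F ^ 2)) * t + 2 * (t / (4 * F ^ 2)) ^ 2 * F ^ 2 =
          -(1 / 8) * (t ^ 2 / F ^ 2) := by field_simp; ring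
      linarith
  · refine ⟨1 / (4 * s), by positivity, le_of_eq (by field_simp), ?_⟩
    have := min_le_right (t ^ 2 / F ^ 2) (t / s)
    have e : t / s = 8 * (1 / (4 * s) * t / 2) := by field_simp; ring
    have e2 : 2 * (1 / (4 * s)) * F ^ 2 * (1 / (4 * s)) ≤
        2 * (1 / (4 * s)) * F ^ 2 * (t / (4 * F ^ 2)) := by gcongr
    have e3 : 2 * (1 / (4 * s)) * F ^ 2 * (t / (4 * F ^ 2)) = 1 / (4 * s) * t / 2 := by
      field_simp; ring
    nlinarith

end Scalar

section Diagonalization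

variable {ι : Type*} [Fintype ι]

lemma frobNorm_nonneg (M : Matrix ι ι ℝ) : 0 ≤ frobNorm M := Real.sqrt_nonneg _

lemma frobNorm_sq (M : Matrix ι ι ℝ) : frobNorm M ^ 2 = ∑ i, ∑ j, M i j ^ 2 :=
  Real.sq_sqrt (by positivity)

lemma frobNorm_sq_eq_trace (M : Matrix ι ι ℝ) : frobNorm M ^ 2 = (M * Mᵀ).trace := by
  rw [frobNorm_sq]
  simp [Matrix.trace, Matrix.mul_apply, sq]

variable [DecidableEq ι]

lemma specNorm_nonneg (M : Matrix ι ι ℝ) : 0 ≤ specNorm M := norm_nonneg _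

lemma abs_dotProduct_mulVec_le_specNorm (M : Matrix ι ι ℝ) (v : EuclideanSpace ℝ ι)
    (hv : ‖v‖ = 1) : |v.ofLp ⬝ᵥ M *ᵥ v.ofLp| ≤ specNorm M := by
  have h : v.ofLp ⬝ᵥ M *ᵥ v.ofLp = inner ℝ (Matrix.toEuclideanCLM (𝕜 := ℝ) M v) v := by
    simp [EuclideanSpace.inner_eq_star_dotProduct]
  rw [h]
  refine (abs_real_inner_le_norm _ _).trans ?_
  simpa [hv, specNorm] using (Matrix.toEuclideanCLM (𝕜 := ℝ) M).le_opNorm v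

/-- Orthogonal diagonalization of the quadratic form of `M`. -/
lemma exists_orthogonal_diagonalization (M : Matrix ι ι ℝ) :
    ∃ (U : Matrix ι ι ℝ) (l : ι → ℝ), Uᵀ * U = 1 ∧
      (∀ y, (U *ᵥ y) ⬝ᵥ M *ᵥ (U *ᵥ y) = ∑ i, l i * y i ^ 2) ∧
      ∑ i, l i ^ 2 ≤ frobNorm M ^ 2 ∧ ∀ i, |l i| ≤ specNorm M := by
  have hS : ((1 / 2 : ℝ) • (M + Mᵀ)).IsHermitian := by
    simp [Matrix.IsHermitian, Matrix.conjTranspose_eq_transpose_of_trivial, add_comm]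
  let U : Matrix ι ι ℝ := (hS.eigenvectorUnitary : Matrix ι ι ℝ)
  have hUU : Uᵀ * U = 1 := Unitary.coe_star_mul_self hS.eigenvectorUnitary
  have hUU' : U * Uᵀ = 1 := Unitary.coe_mul_star_self hS.eigenvectorUnitary
  have hD : Uᵀ * ((1 / 2 : ℝ) • (M + Mᵀ)) * U = diagonal hS.eigenvalues := by
    have := hS.conjStarAlgAut_star_eigenvectorUnitary
    rw [Unitary.conjStarAlgAut_star_apply] at this
    exact this
  have hform (v : ι → ℝ) : v ⬝ᵥ ((1 / 2 : ℝ) • (M + Mᵀ)) *ᵥ v = v ⬝ᵥ M *ᵥ v := by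
    have : v ⬝ᵥ Mᵀ *ᵥ v = v ⬝ᵥ M *ᵥ v := by
      rw [mulVec_transpose, dotProduct_comm, dotProduct_mulVec]
    rw [smul_mulVec, dotProduct_smul, add_mulVec, dotProduct_add, this, smul_eq_mul]
    ring
  have hdiag (y : ι → ℝ) :
      (U *ᵥ y) ⬝ᵥ M *ᵥ (U *ᵥ y) = ∑ i, hS.eigenvalues i * y i ^ 2 := by
    rw [← hform, mulVec_mulVec, dotProduct_comm, dotProduct_mulVec, ← mulVec_transpose,
      mulVec_mulVec, ← Matrix.mul_assoc, hD, dotProduct_comm, dotProduct]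
    refine Finset.sum_congr rfl fun i _ => ?_
    rw [mulVec_diagonal]
    ring
  have hentry (i : ι) : (Uᵀ * M * U) i i = hS.eigenvalues i := by
    have h := hdiag (Pi.single i 1)
    rw [mulVec_mulVec, dotProduct_comm, dotProduct_mulVec, ← mulVec_transpose,
      mulVec_mulVec, ← Matrix.mul_assoc] at h
    simpa [Pi.single_apply] using h
  refine ⟨U, hS.eigenvalues, hUU, hdiag, ?_, fun i => ?_⟩
  · have hfrob : frobNorm (Uᵀ * M * U) ^ 2 = frobNorm M ^ 2 := by
      simp only [frobNorm_sq_eq_trace, transpose_mul, transpose_transpose]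
      rw [show Uᵀ * M * U * (Uᵀ * (Mᵀ * U)) = Uᵀ * (M * (U * Uᵀ) * Mᵀ * U) by
        simp only [Matrix.mul_assoc], hUU', Matrix.mul_one, trace_mul_comm, Matrix.mul_assoc,
        hUU', Matrix.mul_one]
    rw [← hfrob, frobNorm_sq]
    refine Finset.sum_le_sum fun i _ => ?_
    rw [← hentry]
    exact Finset.single_le_sum (f := fun j => (Uᵀ * M * U) i j ^ 2)
      (fun j _ => sq_nonneg _) (Finset.mem_univ i)
  · have h := hS.eigenvalues_eq i
    rw [RCLike.re_to_real, star_trivial, hform] at h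
    rw [h]
    exact abs_dotProduct_mulVec_le_specNorm M _ (hS.eigenvectorBasis.orthonormal.1 i)

end Diagonalization

section Gaussian

variable {Ω ι : Type*} [MeasurableSpace Ω] {P : Measure Ω} [Fintype ι]

lemma IsGaussianLaw.map_dotProduct_comp {X : Ω → ι → ℝ} {m : ι → ℝ} {S : Matrix ι ι ℝ}
    (hX : IsGaussianLaw (P.map X) m S) (hXm : Measurable X) (a : ι → ℝ) :
    P.map (fun ω => a ⬝ᵥ X ω) = gaussianReal (a ⬝ᵥ m) (Real.toNNReal (a ⬝ᵥ S *ᵥ a)) := by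
  rw [← hX a, Measure.map_map (by unfold dotProduct; fun_prop) hXm]
  rfl

lemma IsGaussianLaw.map_mulVec {X : Ω → ι → ℝ} {m : ι → ℝ} {S : Matrix ι ι ℝ}
    (hX : IsGaussianLaw (P.map X) m S) (hXm : Measurable X) (B : Matrix ι ι ℝ) :
    IsGaussianLaw (P.map fun ω => B *ᵥ X ω) (B *ᵥ m) (B * S * Bᵀ) := by
  intro a
  have hB : Measurable fun ω => B *ᵥ X ω := by unfold mulVec dotProduct; fun_prop
  rw [Measure.map_map (by unfold dotProduct; fun_prop) hB]
  have h := hX.map_dotProduct_comp hXm (a ᵥ* B)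
  simp only [← dotProduct_mulVec] at h
  rw [← mulVec_mulVec, ← mulVec_mulVec, mulVec_transpose]
  exact h

variable [DecidableEq ι]

lemma IsGaussianLaw.map_eval_of_one {Z : Ω → ι → ℝ} (hZ : IsGaussianLaw (P.map Z) 0 1)
    (hZm : Measurable Z) (i : ι) : P.map (fun ω => Z ω i) = gaussianReal 0 1 := by
  simpa using hZ.map_dotProduct_comp hZm (Pi.single i 1)

lemma IsGaussianLaw.iIndepFun_of_one [IsProbabilityMeasure P] {Z : Ω → ι → ℝ}
    (hZ : IsGaussianLaw (P.map Z) 0 1) (hZm : Measurable Z) :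
    iIndepFun (fun i ω => Z ω i) P := by
  rw [iIndepFun_iff_charFun_pi (by fun_prop)]
  intro t
  have hsum : 0 ≤ t.ofLp ⬝ᵥ t.ofLp := by
    simpa using dotProduct_star_self_nonneg t.ofLp
  have h := congrArg (fun ν => charFun ν 1) (hZ.map_dotProduct_comp hZm t.ofLp)
  have hmeas : Measurable fun ω => t.ofLp ⬝ᵥ Z ω := by unfold dotProduct; fun_prop
  simp only [hZ.map_eval_of_one hZm, charFun_gaussianReal]
  rw [charFun_gaussianReal, charFun_apply_real, integral_map (by fun_prop) (by fun_prop)] at h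
  rw [charFun_apply, integral_map (by fun_prop) (by fun_prop), ← Complex.exp_sum]
  simp only [Complex.ofReal_one, one_mul, one_mulVec, Real.coe_toNNReal _ hsum,
    dotProduct_zero] at h
  simp only [EuclideanSpace.inner_eq_star_dotProduct, star_trivial]
  rw [h]
  congr 1
  simp [dotProduct, Finset.sum_div, sq]

/-- Tail bound for a diagonal quadratic form in independent standard Gaussians. -/
lemma measureReal_diagonal_form_ge_le [IsProbabilityMeasure P] {Z : Ω → ι → ℝ}
    (hZ : IsGaussianLaw (P.map Z) 0 1) (hZm : Measurable Z) (l : ι → ℝ) {F s t : ℝ}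
    (hF : 0 < F) (hs : 0 < s) (ht : 0 < t) (hlF : ∑ i, l i ^ 2 ≤ F ^ 2)
    (hls : ∀ i, |l i| ≤ s) :
    P.real {ω | t ≤ ∑ i, l i * Z ω i ^ 2 - ∑ i, l i} ≤
      Real.exp (-(1 / 8) * min (t ^ 2 / F ^ 2) (t / s)) := by
  obtain ⟨θ, hθ, hθs, hexp⟩ := exists_chernoff_parameter hF hs ht
  have hc (i : ι) : |θ * l i| ≤ 1 / 4 := by
    rw [abs_mul, abs_of_nonneg hθ]
    exact (mul_le_mul_of_nonneg_left (hls i) hθ).trans hθs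
  let Y : ι → Ω → ℝ := fun i ω => l i * Z ω i ^ 2
  have hYm (i : ι) : Measurable (Y i) := by unfold Y; fun_prop
  have hYind : iIndepFun Y P :=
    (hZ.iIndepFun_of_one hZm).comp (fun i x => l i * x ^ 2) (fun i => by fun_prop)
  have hYint (i : ι) : Integrable (fun ω => Real.exp (θ * Y i ω)) P := by
    have h := integrable_exp_mul_sq_gaussianReal (c := θ * l i)
      (by linarith [(abs_le.mp (hc i)).2])
    rw [← hZ.map_eval_of_one hZm i, integrable_map_measure (by fun_prop) (by fun_prop)] at h
    simpa [Y, Function.comp_def, mul_assoc] using h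
  have hmgf (i : ι) : mgf (Y i) P θ ≤ Real.exp (θ * l i + 2 * (θ * l i) ^ 2) := by
    have h := integral_exp_mul_sq_gaussianReal_le (hc i)
    rw [← hZ.map_eval_of_one hZm i, integral_map (by fun_prop) (by fun_prop)] at h
    simpa [mgf, Y, mul_assoc] using h
  have hchernoff := measure_ge_le_exp_mul_mgf (μ := P) (X := ∑ i, Y i) (t + ∑ i, l i) hθ
    (hYind.integrable_exp_mul_sum hYm fun i _ => hYint i)
  have hset : {ω | t ≤ ∑ i, l i * Z ω i ^ 2 - ∑ i, l i} =
      {ω | t + ∑ i, l i ≤ (∑ i, Y i) ω} := by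
    ext ω
    simp [Y, le_sub_iff_add_le]
  rw [hset]
  refine hchernoff.trans ?_
  rw [hYind.mgf_sum hYm]
  calc Real.exp (-θ * (t + ∑ i, l i)) * ∏ i, mgf (Y i) P θ
      ≤ Real.exp (-θ * (t + ∑ i, l i)) * ∏ i, Real.exp (θ * l i + 2 * (θ * l i) ^ 2) := by
        gcongr with i
        · exact fun i _ => mgf_nonneg
        · exact hmgf i
    _ = Real.exp (-θ * t + 2 * θ ^ 2 * ∑ i, l i ^ 2) := by
        rw [← Real.exp_sum, ← Real.exp_add, Finset.sum_add_distrib]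
        simp only [mul_pow, ← Finset.mul_sum]
        congr 1
        ring
    _ ≤ Real.exp (-(1 / 8) * min (t ^ 2 / F ^ 2) (t / s)) := by
        refine Real.exp_le_exp.mpr (le_trans ?_ hexp)
        gcongr

lemma integral_diagonal_form [IsProbabilityMeasure P] {Z : Ω → ι → ℝ}
    (hZ : IsGaussianLaw (P.map Z) 0 1) (hZm : Measurable Z) (l : ι → ℝ) :
    ∫ ω, ∑ i, l i * Z ω i ^ 2 ∂P = ∑ i, l i := by
  rw [integral_finsetSum]
  · refine Finset.sum_congr rfl fun i _ => ?_
    have h := integral_sq_gaussianReal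
    rw [← hZ.map_eval_of_one hZm i, integral_map (by fun_prop) (by fun_prop)] at h
    rw [integral_const_mul, h, mul_one]
  · intro i _
    have h := (memLp_id_gaussianReal (μ := 0) (v := 1) 2).integrable_sq
    rw [← hZ.map_eval_of_one hZm i, integrable_map_measure (by fun_prop) (by fun_prop)] at h
    exact Integrable.const_mul h _

end Gaussian

/-- **Hanson–Wright-type concentration for Gaussian quadratic forms.**
If `X ∼ N(0, Σ_X)` with `Σ_X ≻ 0`, then for all `t > 0`,
`P(XᵀAX − E[XᵀAX] ≥ t) ≤ exp(−(1/8) min(t²/‖Σ_X^{1/2}AΣ_X^{1/2}‖_F², t/‖Σ_X^{1/2}AΣ_X^{1/2}‖₂))`. -/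
theorem hanson_wright_gaussian
    {Ω : Type*} [MeasurableSpace Ω] (Pr : Measure Ω) [IsProbabilityMeasure Pr]
    (n : ℕ) (SX SXhalf : Matrix (Fin n) (Fin n) ℝ)
    (hSX : SX.PosDef) (hhalf : SXhalf.PosDef) (hsq : SXhalf * SXhalf = SX)
    (X : Ω → Fin n → ℝ) (hXmeas : Measurable X)
    (hlaw : IsGaussianLaw (Pr.map X) 0 SX)
    (A : Matrix (Fin n) (Fin n) ℝ) :
    ∀ t : ℝ, 0 < t →
      Pr {ω | t ≤ X ω ⬝ᵥ A *ᵥ X ω - ∫ ω', X ω' ⬝ᵥ A *ᵥ X ω' ∂Pr}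
        ≤ ENNReal.ofReal (Real.exp (-(1/8) *
            min (t ^ 2 / frobNorm (SXhalf * A * SXhalf) ^ 2)
                (t / specNorm (SXhalf * A * SXhalf)))) := by
  intro t ht
  rcases (frobNorm_nonneg (SXhalf * A * SXhalf)).eq_or_lt with hF | hF
  · have hmin : min (t ^ 2 / frobNorm (SXhalf * A * SXhalf) ^ 2)
        (t / specNorm (SXhalf * A * SXhalf)) = 0 := by
      rw [← hF]
      simpa using div_nonneg ht.le (specNorm_nonneg _)
    simpa [hmin] using prob_le_one
  rcases (specNorm_nonneg (SXhalf * A * SXhalf)).eq_or_lt with hs | hs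
  · have hmin : min (t ^ 2 / frobNorm (SXhalf * A * SXhalf) ^ 2)
        (t / specNorm (SXhalf * A * SXhalf)) = 0 := by
      rw [← hs]
      simpa using div_nonneg (sq_nonneg t) (sq_nonneg _)
    simpa [hmin] using prob_le_one
  obtain ⟨U, l, hUU, hdiag, hlF, hls⟩ := exists_orthogonal_diagonalization (SXhalf * A * SXhalf)
  have hUU' : U * Uᵀ = 1 := mul_eq_one_comm.mp hUU
  have hdet : IsUnit SXhalf.det := SXhalf.isUnit_iff_isUnit_det.mp hhalf.isUnit
  have hsymm : SXhalfᵀ = SXhalf := by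
    simpa [Matrix.conjTranspose_eq_transpose_of_trivial] using hhalf.isHermitian.eq
  have hinv : SXhalf⁻¹ᵀ = SXhalf⁻¹ := by rw [transpose_nonsing_inv, hsymm]
  let Z : Ω → Fin n → ℝ := fun ω => (Uᵀ * SXhalf⁻¹) *ᵥ X ω
  have hZm : Measurable Z := by unfold Z mulVec dotProduct; fun_prop
  have hZ : IsGaussianLaw (Pr.map Z) 0 1 := by
    have h := hlaw.map_mulVec hXmeas (Uᵀ * SXhalf⁻¹)
    have hcov : Uᵀ * SXhalf⁻¹ * SX * (Uᵀ * SXhalf⁻¹)ᵀ = 1 := by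
      rw [transpose_mul, hinv, transpose_transpose, ← hsq]
      calc Uᵀ * SXhalf⁻¹ * (SXhalf * SXhalf) * (SXhalf⁻¹ * U)
          = Uᵀ * (SXhalf⁻¹ * SXhalf) * (SXhalf * SXhalf⁻¹) * U := by
            simp only [Matrix.mul_assoc]
        _ = 1 := by
            rw [nonsing_inv_mul _ hdet, mul_nonsing_inv _ hdet, Matrix.mul_one, Matrix.mul_one,
              hUU]
    rwa [mulVec_zero, hcov] at h
  have hXZ (ω : Ω) : X ω = SXhalf *ᵥ (U *ᵥ Z ω) := by
    simp only [Z, mulVec_mulVec]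
    rw [← Matrix.mul_assoc U, hUU', Matrix.one_mul,
      mul_nonsing_inv _ hdet, one_mulVec]
  have hform (ω : Ω) : X ω ⬝ᵥ A *ᵥ X ω = ∑ i, l i * Z ω i ^ 2 := by
    rw [← hdiag, hXZ]
    generalize U *ᵥ Z ω = y
    simp only [← mulVec_mulVec]
    rw [dotProduct_mulVec y, ← mulVec_transpose, hsymm]
  simp only [hform, integral_diagonal_form hZ hZm]
  rw [← ofReal_measureReal]
  exact ENNReal.ofReal_le_ofReal
    (measureReal_diagonal_form_ge_le hZ hZm l hF hs ht hlF hls)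
end

section
/- Let W be an ℝ^m-valued Gaussian random vector with law N(0, Σ), where Σ ∈ ℝ^{m×m} is symmetric positive definite with symmetric positive definite square root Σ^{1/2}. Let a ∈ ℝ^m with a ≠ 0, let A ∈ ℝ^{m×m} be symmetric with A ≠ 0, and let ε₁, ε₂ > 0. Then P( aᵀW + WᵀAW − E[WᵀAW] ≥ ε₁ + ε₂ ) ≤ exp( −ε₁²/(2‖Σ^{1/2}a‖₂²) ) + exp{ −(1/8) min( ε₂²/‖Σ^{1/2}AΣ^{1/2}‖_F², ε₂/‖Σ^{1/2}AΣ^{1/2}‖₂ ) }. -/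
open Matrix MeasureTheory ProbabilityTheory

namespace GaussianTail
open Real

lemma exp_neg_add_sq_le_one_sub {x : ℝ} (hx : |x| ≤ 1 / 2) : Real.exp (-(x + x ^ 2)) ≤ 1 - x := by
  obtain ⟨h1, h2⟩ := abs_le.mp hx
  rw [Real.exp_neg, inv_le_comm₀ (Real.exp_pos _) (by linarith),
    inv_le_iff_one_le_mul₀ (by linarith)]
  rcases le_total x 0 with h | h
  · have := Real.add_one_le_exp (x + x ^ 2)
    nlinarith [mul_nonneg (neg_nonneg.2 h) (sq_nonneg x)]
  · have := Real.quadratic_le_exp_of_nonneg (x := x + x ^ 2) (by positivity)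
    calc (1 : ℝ) ≤ (1 + (x + x ^ 2) + (x + x ^ 2) ^ 2 / 2) * (1 - x) := by
          have h4 : 0 ≤ x ^ 2 * (1 / 2 - x) * (1 + x) := by
            have : 0 ≤ 1 / 2 - x := by linarith
            positivity
          have h5 : 0 ≤ x ^ 4 * (1 - x) := by
            have : 0 ≤ 1 - x := by linarith
            positivity
          nlinarith
      _ ≤ _ := by gcongr; linarith

lemma integrable_exp_mul_sq_gaussianReal {s : ℝ} (hs : s < 1 / 2) :
    Integrable (fun z : ℝ => Real.exp (s * z ^ 2)) (gaussianReal 0 1) := by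
  rw [gaussianReal_of_var_ne_zero _ one_ne_zero,
    integrable_withDensity_iff_integrable_smul' (by fun_prop) (by simp [gaussianPDF])]
  have h := (integrable_exp_neg_mul_sq (b := 1 / 2 - s) (by linarith)).const_mul (√(2 * π))⁻¹
  refine h.congr (.of_forall fun z => ?_)
  simp only [toReal_gaussianPDF, gaussianPDFReal_def, smul_eq_mul, NNReal.coe_one, mul_one,
    sub_zero, mul_assoc, ← Real.exp_add]
  congr 2
  ring

lemma integral_exp_mul_sq_gaussianReal {s : ℝ} (hs : s < 1 / 2) :
    ∫ z, Real.exp (s * z ^ 2) ∂(gaussianReal 0 1) = (√(1 - 2 * s))⁻¹ := by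
  rw [integral_gaussianReal_eq_integral_smul one_ne_zero]
  have h : ∀ z : ℝ, gaussianPDFReal 0 1 z • Real.exp (s * z ^ 2) =
      (√(2 * π))⁻¹ * Real.exp (-(1 / 2 - s) * z ^ 2) := fun z => by
    simp only [gaussianPDFReal_def, smul_eq_mul, NNReal.coe_one, mul_one,
      sub_zero, mul_assoc, ← Real.exp_add]
    congr 2
    ring
  simp_rw [h]
  rw [integral_const_mul, integral_gaussian, ← Real.sqrt_inv, ← Real.sqrt_inv,
    ← Real.sqrt_mul (by positivity)]
  congr 1
  have : 1 - 2 * s ≠ 0 := by linarith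
  have : 1 / 2 - s ≠ 0 := by linarith
  field_simp

lemma integral_exp_mul_sq_sub_one_le {s : ℝ} (hs : |s| ≤ 1 / 4) :
    ∫ z, Real.exp (s * (z ^ 2 - 1)) ∂(gaussianReal 0 1) ≤ Real.exp (2 * s ^ 2) := by
  obtain ⟨h1, h2⟩ := abs_le.mp hs
  simp_rw [mul_sub, mul_one, sub_eq_add_neg, Real.exp_add]
  rw [integral_mul_const, integral_exp_mul_sq_gaussianReal (by linarith)]
  have h := exp_neg_add_sq_le_one_sub (x := 2 * s) (by rw [abs_mul, abs_two]; linarith)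
  have h' : Real.exp (-(s + 2 * s ^ 2)) ≤ √(1 - 2 * s) := by
    refine Real.le_sqrt_of_sq_le ?_
    rw [← Real.exp_nat_mul]
    convert h using 2
    push_cast
    ring
  rw [inv_mul_le_iff₀ (Real.sqrt_pos.2 (by linarith))]
  refine le_trans ?_ (mul_le_mul_of_nonneg_right h' (Real.exp_pos _).le)
  rw [← Real.exp_add]
  exact (congrArg Real.exp (by ring)).le

lemma integral_sq_gaussianReal : ∫ z, z ^ 2 ∂(gaussianReal 0 1) = 1 := by
  have h := variance_fun_id_gaussianReal (μ := 0) (v := 1)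
  rw [variance_of_integral_eq_zero (by fun_prop) (by simp)] at h
  simpa using h

lemma integrable_sq_gaussianReal : Integrable (fun z : ℝ => z ^ 2) (gaussianReal 0 1) :=
  (memLp_id_gaussianReal 2).integrable_sq

variable {ι : Type*} [Fintype ι]

lemma integral_sum_mul_sq_pi (l : ι → ℝ) :
    ∫ z, ∑ i, l i * z i ^ 2 ∂(Measure.pi fun _ : ι => gaussianReal 0 1) = ∑ i, l i := by
  have hm (i : ι) := measurePreserving_eval (fun _ : ι => gaussianReal 0 1) i
  rw [integral_finsetSum]
  · refine Finset.sum_congr rfl fun i _ => ?_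
    rw [integral_const_mul]
    have h := integral_map (μ := Measure.pi fun _ : ι => gaussianReal 0 1)
      (φ := Function.eval i) (f := fun z : ℝ => z ^ 2) 
      (measurable_pi_apply i).aemeasurable (by fun_prop)
    rw [(hm i).map_eq, integral_sq_gaussianReal] at h
    exact (congrArg (l i * ·) h.symm).trans (mul_one _)
  · exact fun i _ => ((hm i).integrable_comp_of_integrable integrable_sq_gaussianReal).const_mul _

lemma measure_pi_sum_mul_sq_sub_one_le (l : ι → ℝ) {t : ℝ} (ht : 0 ≤ t)
    (hl : ∀ i, t * |l i| ≤ 1 / 4) (ε : ℝ) :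
    (Measure.pi fun _ : ι => gaussianReal 0 1).real {z | ε ≤ ∑ i, l i * (z i ^ 2 - 1)} ≤
      Real.exp (-t * ε + 2 * t ^ 2 * ∑ i, l i ^ 2) := by
  have hs (i : ι) : |t * l i| ≤ 1 / 4 := by rw [abs_mul, abs_of_nonneg ht]; exact hl i
  have hexp (z : ι → ℝ) : Real.exp (t * ∑ i, l i * (z i ^ 2 - 1)) =
      ∏ i, Real.exp (t * l i * (z i ^ 2 - 1)) := by
    rw [← Real.exp_sum, Finset.mul_sum]
    simp_rw [mul_assoc]
  have hint (i : ι) : Integrable (fun z : ℝ => Real.exp (t * l i * (z ^ 2 - 1)))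
      (gaussianReal 0 1) := by
    simp_rw [mul_sub, mul_one, sub_eq_add_neg, Real.exp_add]
    exact (integrable_exp_mul_sq_gaussianReal (by linarith [(abs_le.mp (hs i)).2])).mul_const _
  refine (measure_ge_le_exp_mul_mgf ε ht ?_).trans ?_
  · simp_rw [hexp]
    exact Integrable.fintype_prod hint
  · rw [Real.exp_add]
    gcongr
    simp_rw [mgf, hexp]
    rw [integral_fintype_prod_eq_prod (f := fun i z => Real.exp (t * l i * (z ^ 2 - 1))),
      Finset.mul_sum, Real.exp_sum]
    refine Finset.prod_le_prod (fun i _ => integral_nonneg fun z => (Real.exp_pos _).le)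
      fun i _ => (integral_exp_mul_sq_sub_one_le (hs i)).trans_eq ?_
    congr 1
    ring

lemma measure_pi_sum_mul_sq_sub_one_le_exp_min (l : ι → ℝ) {F L ε : ℝ} (hF : 0 < F) (hL : 0 < L)
    (hε : 0 ≤ ε) (hlF : ∑ i, l i ^ 2 = F) (hlL : ∀ i, |l i| ≤ L) :
    (Measure.pi fun _ : ι => gaussianReal 0 1).real {z | ε ≤ ∑ i, l i * (z i ^ 2 - 1)} ≤
      Real.exp (-(1 / 8) * min (ε ^ 2 / F) (ε / L)) := by
  set t := min (ε / (4 * F)) (1 / (4 * L)) with ht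
  have ht0 : 0 ≤ t := by positivity
  refine (measure_pi_sum_mul_sq_sub_one_le l ht0 (fun i => ?_) ε).trans
    (Real.exp_le_exp.2 ?_)
  · calc t * |l i| ≤ 1 / (4 * L) * L := by gcongr; exacts [min_le_right _ _, hlL i]
      _ = 1 / 4 := by field_simp
  · rw [hlF]
    have key : 2 * t ^ 2 * F ≤ t * ε / 2 := by
      have : t * (4 * F) ≤ ε := (le_div_iff₀ (by positivity)).1 (min_le_left _ _)
      nlinarith
    have hte : min (ε ^ 2 / F) (ε / L) = 4 * (t * ε) := by
      rw [ht, min_mul_of_nonneg _ _ hε, mul_min_of_nonneg _ _ (by norm_num)]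
      congr 1 <;> field_simp
    rw [hte]
    linarith

lemma isGaussianLaw_map_mulVec {κ : Type*} [Fintype κ] {μ : Measure (ι → ℝ)} {S : Matrix ι ι ℝ}
    (h : IsGaussianLaw μ 0 S) (M : Matrix κ ι ℝ) :
    IsGaussianLaw (μ.map (M *ᵥ ·)) 0 (M * S * Mᵀ) := by
  intro b
  rw [Measure.map_map (by fun_prop) (by fun_prop)]
  have := h (b ᵥ* M)
  have hq : b ⬝ᵥ (M * S * Mᵀ) *ᵥ b = (b ᵥ* M) ⬝ᵥ S *ᵥ (b ᵥ* M) := by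
    rw [← mulVec_mulVec, ← mulVec_mulVec, mulVec_transpose, dotProduct_mulVec]
  simpa only [Function.comp_def, dotProduct_mulVec, dotProduct_zero, hq] using! this

lemma eq_pi_of_isGaussianLaw_one {μ : Measure (ι → ℝ)} [IsFiniteMeasure μ] [DecidableEq ι]
    (h : IsGaussianLaw μ 0 1) : μ = Measure.pi fun _ : ι => gaussianReal 0 1 := by
  rw [← charFun_eq_pi_iff]
  intro t
  have h1 := h t.ofLp
  have : charFun (μ.map (WithLp.toLp 2)) t = charFun (μ.map (fun x => t.ofLp ⬝ᵥ x)) 1 := by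
    rw [charFun_apply, charFun_apply, integral_map (by fun_prop) (by fun_prop),
      integral_map (by fun_prop) (by fun_prop)]
    simp [PiLp.inner_apply, dotProduct]
  rw [this, h1]
  simp only [charFun_gaussianReal, ← Complex.exp_sum, one_mulVec, dotProduct_zero]
  congr 1
  have h0 : 0 ≤ ∑ i, t.ofLp i ^ 2 := by positivity
  simp [dotProduct, ← pow_two, max_eq_left h0, Finset.sum_div]

lemma measure_ge_le_of_map_eq_gaussianReal {Ω : Type*} [MeasurableSpace Ω] {P : Measure Ω}
    [IsFiniteMeasure P] {X : Ω → ℝ} (hX : AEMeasurable X P) {v : NNReal} (hv : v ≠ 0)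
    (h : P.map X = gaussianReal 0 v) {ε : ℝ} (hε : 0 ≤ ε) :
    P.real {ω | ε ≤ X ω} ≤ Real.exp (-(ε ^ 2) / (2 * v)) := by
  have hint : Integrable (fun ω => Real.exp (ε / v * X ω)) P := by
    have := integrable_exp_mul_gaussianReal (μ := 0) (v := v) (ε / v)
    rw [← h] at this
    exact this.comp_aemeasurable hX
  refine (measure_ge_le_exp_mul_mgf ε (by positivity) hint).trans_eq ?_
  rw [mgf_gaussianReal h, ← Real.exp_add]
  congr 1
  have : (v : ℝ) ≠ 0 := by exact_mod_cast hv
  field_simp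
  ring

lemma frobNorm_pos {B : Matrix ι ι ℝ} (hB : B ≠ 0) : 0 < frobNorm B := by
  refine Real.sqrt_pos.2 ?_
  obtain ⟨i, j, hij⟩ : ∃ i j, B i j ≠ 0 := by
    by_contra! h
    exact hB (Matrix.ext h)
  exact Finset.sum_pos' (fun _ _ => by positivity) ⟨i, Finset.mem_univ _,
    Finset.sum_pos' (fun _ _ => by positivity) ⟨j, Finset.mem_univ _, by positivity⟩⟩

section Spectral

variable [DecidableEq ι] {B : Matrix ι ι ℝ}

lemma frobNorm_sq_eq_sum_eigenvalues_sq (hB : B.IsHermitian) :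
    frobNorm B ^ 2 = ∑ i, hB.eigenvalues i ^ 2 := by
  have htr : frobNorm B ^ 2 = (B * B).trace := by
    rw [frobNorm, Real.sq_sqrt (by positivity)]
    refine Finset.sum_congr rfl fun i _ => ?_
    rw [diag_apply, mul_apply]
    refine Finset.sum_congr rfl fun j _ => ?_
    rw [pow_two, ← hB.apply j i, star_trivial]
  rw [htr]
  conv_lhs => rw [hB.spectral_theorem, ← map_mul, Unitary.conjStarAlgAut_apply, trace_mul_comm,
    ← mul_assoc, Unitary.coe_star_mul_self, one_mul, diagonal_mul_diagonal, trace_diagonal]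
  simp [pow_two]

lemma abs_eigenvalues_le_specNorm (hB : B.IsHermitian) (i : ι) :
    |hB.eigenvalues i| ≤ specNorm B := by
  have h := (Matrix.toEuclideanCLM (𝕜 := ℝ) B).le_opNorm (hB.eigenvectorBasis i)
  have he : Matrix.toEuclideanCLM (𝕜 := ℝ) B (hB.eigenvectorBasis i) =
      hB.eigenvalues i • hB.eigenvectorBasis i :=
    WithLp.ofLp_injective 2 (by simpa using! hB.mulVec_eigenvectorBasis i)
  rwa [he, norm_smul, hB.eigenvectorBasis.norm_eq_one, mul_one, mul_one, Real.norm_eq_abs] at h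

lemma specNorm_pos (hB : B ≠ 0) : 0 < specNorm B :=
  norm_pos_iff.2 fun h => hB ((map_eq_zero_iff _ (Matrix.toEuclideanCLM (𝕜 := ℝ)).injective).1 h)

end Spectral

section Quadratic

variable [DecidableEq ι] {Ω : Type*} [MeasurableSpace Ω] {P : Measure Ω} [IsProbabilityMeasure P]
  {R A : Matrix ι ι ℝ} {W : Ω → ι → ℝ}

lemma exists_map_eq_pi_and_quadratic_eq_sum (hR : R.PosDef) (hW : Measurable W)
    (hlaw : IsGaussianLaw (P.map W) 0 (R * R)) (hB : (R * A * R).IsHermitian) :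
    ∃ Z : Ω → ι → ℝ, Measurable Z ∧ P.map Z = (Measure.pi fun _ : ι => gaussianReal 0 1) ∧
      ∀ ω, W ω ⬝ᵥ A *ᵥ W ω = ∑ i, hB.eigenvalues i * Z ω i ^ 2 := by
  have hRT : Rᵀ = R := by
    rw [← conjTranspose_eq_transpose_of_trivial]
    exact hR.isHermitian
  have hdet : IsUnit R.det := hR.det_pos.ne'.isUnit
  set U : Matrix ι ι ℝ := (hB.eigenvectorUnitary : Matrix ι ι ℝ)
  have hUT : star U = Uᵀ := conjTranspose_eq_transpose_of_trivial U
  have hU1 : Uᵀ * U = 1 := hUT ▸ Unitary.coe_star_mul_self hB.eigenvectorUnitary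
  have hspec : R * A * R = U * diagonal hB.eigenvalues * Uᵀ := by
    rw [← hUT]
    exact hB.spectral_theorem
  refine ⟨fun ω => (Uᵀ * R⁻¹) *ᵥ W ω, by fun_prop, ?_, fun ω => ?_⟩
  · have h := isGaussianLaw_map_mulVec hlaw (Uᵀ * R⁻¹)
    have h1 : Uᵀ * R⁻¹ * (R * R) * (Uᵀ * R⁻¹)ᵀ = 1 := by
      rw [transpose_mul, transpose_nonsing_inv, hRT, transpose_transpose, mul_assoc Uᵀ,
        nonsing_inv_mul_cancel_left _ _ hdet, mul_assoc Uᵀ, mul_nonsing_inv_cancel_left _ _ hdet,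
        hU1]
    rw [h1, Measure.map_map (by fun_prop) hW] at h
    exact eq_pi_of_isGaussianLaw_one h
  · have hA : A = (Uᵀ * R⁻¹)ᵀ * diagonal hB.eigenvalues * (Uᵀ * R⁻¹) := by
      rw [transpose_mul, transpose_nonsing_inv, hRT, transpose_transpose]
      calc A = R⁻¹ * (R * A * R) * R⁻¹ := by
            rw [mul_assoc R, nonsing_inv_mul_cancel_left _ _ hdet,
              mul_nonsing_inv_cancel_right _ _ hdet]
        _ = R⁻¹ * (U * diagonal hB.eigenvalues * Uᵀ) * R⁻¹ := congrArg (R⁻¹ * · * R⁻¹) hspec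
        _ = _ := by simp only [mul_assoc]
    conv_lhs => rw [hA, ← mulVec_mulVec, ← mulVec_mulVec, dotProduct_mulVec, vecMul_transpose]
    simp only [dotProduct, mulVec_diagonal]
    exact Finset.sum_congr rfl fun i _ => by ring

lemma measure_quadratic_ge_le_exp_min (hR : R.PosDef) (hW : Measurable W)
    (hlaw : IsGaussianLaw (P.map W) 0 (R * R)) (hA : A.IsSymm) (hA0 : A ≠ 0) {ε : ℝ}
    (hε : 0 ≤ ε) :
    P.real {ω | ε ≤ W ω ⬝ᵥ A *ᵥ W ω - ∫ ω', W ω' ⬝ᵥ A *ᵥ W ω' ∂P} ≤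
      Real.exp (-(1 / 8) * min (ε ^ 2 / frobNorm (R * A * R) ^ 2)
        (ε / specNorm (R * A * R))) := by
  have hRT : Rᵀ = R := by
    rw [← conjTranspose_eq_transpose_of_trivial]
    exact hR.isHermitian
  have hB : (R * A * R).IsHermitian := by
    rw [IsHermitian, conjTranspose_eq_transpose_of_trivial, transpose_mul, transpose_mul, hRT,
      hA.eq, mul_assoc]
  have hB0 : R * A * R ≠ 0 := by
    rw [Ne, hR.isUnit.mul_left_eq_zero, hR.isUnit.mul_right_eq_zero]
    exact hA0
  obtain ⟨Z, hZ, hmap, hquad⟩ := exists_map_eq_pi_and_quadratic_eq_sum hR hW hlaw hB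
  have hE : ∫ ω', W ω' ⬝ᵥ A *ᵥ W ω' ∂P = ∑ i, hB.eigenvalues i := by
    simp_rw [hquad]
    rw [← integral_sum_mul_sq_pi, ← hmap, integral_map hZ.aemeasurable
      (Measurable.aestronglyMeasurable (by fun_prop))]
  rw [hE]
  have hset : {ω | ε ≤ W ω ⬝ᵥ A *ᵥ W ω - ∑ i, hB.eigenvalues i} =
      Z ⁻¹' {z | ε ≤ ∑ i, hB.eigenvalues i * (z i ^ 2 - 1)} := by
    ext ω
    simp [hquad, mul_sub]
  rw [hset, ← map_measureReal_apply hZ (measurableSet_le (by fun_prop) (by fun_prop)), hmap]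
  exact measure_pi_sum_mul_sq_sub_one_le_exp_min _ (pow_pos (frobNorm_pos hB0) 2)
    (specNorm_pos hB0) hε (frobNorm_sq_eq_sum_eigenvalues_sq hB).symm
    (abs_eigenvalues_le_specNorm hB)

end Quadratic

end GaussianTail

/-- **Combined tail bound for an affine-plus-quadratic Gaussian functional.**
If `W ∼ N(0, Σ)`, `Σ ≻ 0`, `a ≠ 0`, and `A` is symmetric nonzero, then for all
`ε₁, ε₂ > 0`,
`P(aᵀW + WᵀAW − E[WᵀAW] ≥ ε₁ + ε₂) ≤ exp(−ε₁²/(2‖Σ^{1/2}a‖₂²)) +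
exp(−(1/8) min(ε₂²/‖Σ^{1/2}AΣ^{1/2}‖_F², ε₂/‖Σ^{1/2}AΣ^{1/2}‖₂))`. -/
theorem gaussian_affine_quadratic_tail_bound
    {Ω : Type*} [MeasurableSpace Ω] (Pr : Measure Ω) [IsProbabilityMeasure Pr]
    (m : ℕ) (S Shalf : Matrix (Fin m) (Fin m) ℝ)
    (hS : S.PosDef) (hShalf : Shalf.PosDef) (hsq : Shalf * Shalf = S)
    (W : Ω → Fin m → ℝ) (hWmeas : Measurable W)
    (hlaw : IsGaussianLaw (Pr.map W) 0 S)
    (a : Fin m → ℝ) (ha : a ≠ 0)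
    (A : Matrix (Fin m) (Fin m) ℝ) (hA : A.IsSymm) (hA0 : A ≠ 0)
    (ε₁ ε₂ : ℝ) (hε₁ : 0 < ε₁) (hε₂ : 0 < ε₂) :
    Pr {ω | ε₁ + ε₂ ≤ a ⬝ᵥ W ω + W ω ⬝ᵥ A *ᵥ W ω - ∫ ω', W ω' ⬝ᵥ A *ᵥ W ω' ∂Pr}
      ≤ ENNReal.ofReal (Real.exp (-(ε₁ ^ 2) / (2 * ((Shalf *ᵥ a) ⬝ᵥ (Shalf *ᵥ a)))))
        + ENNReal.ofReal (Real.exp (-(1/8) *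
            min (ε₂ ^ 2 / frobNorm (Shalf * A * Shalf) ^ 2)
                (ε₂ / specNorm (Shalf * A * Shalf)))) := by
  subst hsq
  have hST : Shalfᵀ = Shalf := by
    rw [← conjTranspose_eq_transpose_of_trivial]
    exact hShalf.isHermitian
  have hvar : a ⬝ᵥ (Shalf * Shalf) *ᵥ a = (Shalf *ᵥ a) ⬝ᵥ (Shalf *ᵥ a) := by
    rw [← mulVec_mulVec, dotProduct_mulVec, ← mulVec_transpose, hST]
  have hpos : 0 < (Shalf *ᵥ a) ⬝ᵥ (Shalf *ᵥ a) := by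
    rw [← hvar]
    simpa using hS.dotProduct_mulVec_pos ha
  have hlin := hlaw a
  rw [Measure.map_map (by fun_prop) hWmeas, dotProduct_zero, hvar] at hlin
  have h₁ := GaussianTail.measure_ge_le_of_map_eq_gaussianReal (by fun_prop)
    (Real.toNNReal_pos.2 hpos).ne' hlin hε₁.le
  rw [Real.coe_toNNReal _ hpos.le] at h₁
  have h₂ := GaussianTail.measure_quadratic_ge_le_exp_min hShalf hWmeas hlaw hA hA0 hε₂.le
  calc _ ≤ Pr ({ω | ε₁ ≤ a ⬝ᵥ W ω} ∪
        {ω | ε₂ ≤ W ω ⬝ᵥ A *ᵥ W ω - ∫ ω', W ω' ⬝ᵥ A *ᵥ W ω' ∂Pr}) := by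
        refine measure_mono fun ω hω => ?_
        by_contra h
        simp only [Set.mem_union, Set.mem_ofPred_eq, not_or, not_le] at h hω
        linarith
    _ ≤ _ := measure_union_le _ _
    _ ≤ _ := add_le_add
        (ENNReal.le_ofReal_iff_toReal_le (measure_ne_top _ _) (Real.exp_pos _).le |>.2 h₁)
        (ENNReal.le_ofReal_iff_toReal_le (measure_ne_top _ _) (Real.exp_pos _).le |>.2 h₂)
end
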